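/- Let T be a linear involution without connection. If T is nonorientable, then its natural coding L(T) is uniformly recurrent. If T is orientable, then L(T) is uniformly semi-recurrent. -/

import Mathlib

open Set

namespace LinInv

/-- A letter of the extended alphabet `A ∪ A⁻¹`, encoded as a pair of a letter
of `A` and a sign. -/
abbrev Letter (A : Type*) := A × Bool

/-- The formal inverse of a letter. -/
def Letter.inv {A : Type*} (c : Letter A) : Letter A := (c.1, !c.2)

/-- The inverse of a word over `A ∪ A⁻¹`. -/
def wordInv {A : Type*} (u : List (Letter A)) : List (Letter A) :=
  (u.map Letter.inv).reverse

/-- The involution `σ₂` exchanging the two components of `Î = I × {0,1}`. -/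
def s2 (z : ℝ × Bool) : ℝ × Bool := (z.1, !z.2)

/-- A linear involution on the alphabet `A`: the open interval `I = ]lo,hi[`,
for each `c ∈ A ∪ A⁻¹` an open subinterval `I_c = ]endLo c, endHi c[ × {comp c}`
of one of the two components of `Î = I × {0,1}`, the finite set `Sig` of division
points, and the first involution `σ₁`, subject to the defining conditions. -/
structure LinearInvolution (A : Type*) [Fintype A] where
  lo : ℝ
  hi : ℝ
  lo_lt_hi : lo < hi
  endLo : Letter A → ℝ
  endHi : Letter A → ℝ
  end_lt : ∀ c, endLo c < endHi c
  comp : Letter A → Bool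
  sub_lo : ∀ c, lo ≤ endLo c
  sub_hi : ∀ c, endHi c ≤ hi
  /-- the length data satisfy `λ_a = λ_{a⁻¹}` -/
  len_inv : ∀ c, endHi c - endLo c = endHi (Letter.inv c) - endLo (Letter.inv c)
  /-- the set of division points -/
  Sig : Set (ℝ × Bool)
  Sig_sub : Sig ⊆ Ioo lo hi ×ˢ (univ : Set Bool)
  /-- there are `2k-2` division points -/
  Sig_card : Sig.ncard = 2 * Fintype.card A - 2
  /-- the intervals `I_c` are pairwise disjoint -/
  disj : ∀ c d : Letter A, c ≠ d →
    Disjoint (Ioo (endLo c) (endHi c) ×ˢ ({comp c} : Set Bool))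
      (Ioo (endLo d) (endHi d) ×ˢ ({comp d} : Set Bool))
  Sig_disj : ∀ c : Letter A,
    Disjoint Sig (Ioo (endLo c) (endHi c) ×ˢ ({comp c} : Set Bool))
  /-- the intervals `I_c` partition `Î` minus the division points -/
  cover : Ioo lo hi ×ˢ (univ : Set Bool) =
    (⋃ c : Letter A, Ioo (endLo c) (endHi c) ×ˢ ({comp c} : Set Bool)) ∪ Sig
  /-- the first involution `σ₁` (as a total map; only its values on `Î ∖ Σ` matter) -/
  s1 : ℝ × Bool → ℝ × Bool
  s1_invol : ∀ z ∈ (Ioo lo hi ×ˢ (univ : Set Bool)) \ Sig, s1 (s1 z) = z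
  /-- on each `I_c`, `σ₁` is either a translation or a symmetry -/
  s1_iso : ∀ c : Letter A,
    (∃ α : ℝ, ∀ z ∈ Ioo (endLo c) (endHi c) ×ˢ ({comp c} : Set Bool),
        s1 z = (z.1 + α, comp (Letter.inv c))) ∨
    (∃ α : ℝ, ∀ z ∈ Ioo (endLo c) (endHi c) ×ˢ ({comp c} : Set Bool),
        s1 z = (-z.1 + α, comp (Letter.inv c)))
  /-- `σ₁` maps `I_c` onto `I_{c⁻¹}` -/
  s1_image : ∀ c : Letter A,
    s1 '' (Ioo (endLo c) (endHi c) ×ˢ ({comp c} : Set Bool)) =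
      Ioo (endLo (Letter.inv c)) (endHi (Letter.inv c)) ×ˢ
        ({comp (Letter.inv c)} : Set Bool)

namespace LinearInvolution

variable {A : Type*} [Fintype A] (L : LinearInvolution A)

/-- The domain `Î = I × {0,1}`. -/
def Ihat : Set (ℝ × Bool) := Ioo L.lo L.hi ×ˢ (univ : Set Bool)

/-- The interval `I_c` associated with the letter `c ∈ A ∪ A⁻¹`. -/
def Ia (c : Letter A) : Set (ℝ × Bool) :=
  Ioo (L.endLo c) (L.endHi c) ×ˢ ({L.comp c} : Set Bool)

/-- The linear involution `T = σ₂ ∘ σ₁`. -/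
def T (z : ℝ × Bool) : ℝ × Bool := s2 (L.s1 z)

/-- `O = ⋃_{n ≥ 0} T⁻ⁿ(Σ)`, the negative orbit of the singular points. -/
def O : Set (ℝ × Bool) := ⋃ n : ℕ, (L.T)^[n] ⁻¹' L.Sig

/-- `Ô = O ∪ σ₂(O)`. -/
def Ohat : Set (ℝ × Bool) := L.O ∪ s2 '' L.O

/-- `T` has a connection if some singularity `x` of `T⁻¹` reaches a singularity
`y` of `T` in `n ≥ 0` steps. -/
def HasConnection : Prop := ∃ x ∈ s2 '' L.Sig, ∃ n : ℕ, (L.T)^[n] x ∈ L.Sig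

/-- `T` is nonorientable if some `I_c` and `I_{c⁻¹}` lie in the same component. -/
def Nonorientable : Prop := ∃ c : Letter A, L.comp c = L.comp (Letter.inv c)

/-- `T` is orientable if it is not nonorientable. -/
def Orientable : Prop := ¬ L.Nonorientable

/-- `u` occurs in the natural coding of the orbit of `z` at position `m`. -/
def IsCodingFrom (z : ℝ × Bool) (m : ℕ) (u : List (Letter A)) : Prop :=
  ∀ i : Fin u.length, (L.T)^[m + i.1] z ∈ L.Ia (u.get i)

/-- The natural coding `L(T)`: the set of factors of the infinite natural
codings `Σ_T(z)` for `z ∈ Î ∖ Ô`. -/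
def lang : Set (List (Letter A)) :=
  {u | ∃ z ∈ L.Ihat \ L.Ohat, ∃ m : ℕ, L.IsCodingFrom z m u}

/-- The interval `I_w = I_{a₀} ∩ T⁻¹(I_{a₁}) ∩ ⋯ ∩ T^{-m+1}(I_{a_{m-1}})`
associated with a word `w = a₀a₁⋯a_{m-1}`; by convention `I_ε = Î`. -/
def Iw (u : List (Letter A)) : Set (ℝ × Bool) :=
  L.Ihat ∩ ⋂ i : Fin u.length, (L.T)^[i.1] ⁻¹' L.Ia (u.get i)

/-- The return time `ρ_X(x) = inf {n ≥ 1 ∣ Tⁿ(x) ∈ X}`, with value `∞` if the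
orbit of `x` never returns to `X`. -/
noncomputable def retTime (X : Set (ℝ × Bool)) (x : ℝ × Bool) : ℕ∞ :=
  sInf {n : ℕ∞ | ∃ m : ℕ, n = (m : ℕ∞) ∧ 1 ≤ m ∧ (L.T)^[m] x ∈ X}

/-- A word is even if it has an even number of odd letters (a letter `a` is odd
when `I_a` and `I_{a⁻¹}` lie in the same component). -/
def EvenWord (u : List (Letter A)) : Prop :=
  Even (u.countP fun c => L.comp (c.1, true) == L.comp (c.1, false))

/-- The morphism `F_A → ℤ/2ℤ` sending each odd letter to `1` and each even
letter to `0`. -/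
noncomputable def evenHom : FreeGroup A →* Multiplicative (ZMod 2) :=
  FreeGroup.lift fun a =>
    Multiplicative.ofAdd (if L.comp (a, true) = L.comp (a, false) then (1 : ZMod 2) else 0)

/-- The even group: the subgroup of `F_A` formed by the even elements. -/
noncomputable def evenGroup : Subgroup (FreeGroup A) := (L.evenHom).ker

/-- The admissibility condition at an endpoint `x` of an interval `J`:
either `x = Tⁿ(z)` for a singularity `z` of `T⁻¹` with `T^k(z) ∉ J` for
`0 ≤ k ≤ n`, or `Tⁿ(x) = z` for a singularity `z` of `T` with `T^k(x) ∉ J`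
for `0 ≤ k ≤ n`. -/
def AdmissibleEndpoint (J : Set (ℝ × Bool)) (x : ℝ × Bool) : Prop :=
  (∃ z ∈ s2 '' L.Sig, ∃ n : ℕ, (L.T)^[n] z = x ∧ ∀ k ≤ n, (L.T)^[k] z ∉ J) ∨
  (∃ z ∈ L.Sig, ∃ n : ℕ, (L.T)^[n] x = z ∧ ∀ k ≤ n, (L.T)^[k] x ∉ J)

/-- The open interval `]u,v[ × {δ}` is admissible with respect to `T`. -/
def AdmissibleInterval (u v : ℝ) (δ : Bool) : Prop :=
  u < v ∧ L.AdmissibleEndpoint (Ioo u v ×ˢ ({δ} : Set Bool)) (u, δ) ∧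
    L.AdmissibleEndpoint (Ioo u v ×ˢ ({δ} : Set Bool)) (v, δ)

end LinearInvolution

/-- A set of words is factorial if it contains the factors of its elements. -/
def FactorialSet {α : Type*} (S : Set (List α)) : Prop :=
  ∀ u ∈ S, ∀ v : List α, v <:+: u → v ∈ S

/-- A word over `A ∪ A⁻¹` is reduced if it has no factor `c c⁻¹`. -/
def Reduced {A : Type*} (u : List (Letter A)) : Prop :=
  u.Chain' fun c d => d ≠ Letter.inv c

/-- A laminary set on `A`: a symmetric factorial set of reduced words on
`A ∪ A⁻¹`. -/
def Laminary {A : Type*} (S : Set (List (Letter A))) : Prop :=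
  FactorialSet S ∧ (∀ u ∈ S, wordInv u ∈ S) ∧ ∀ u ∈ S, Reduced u

/-- A laminary set is orientable if it splits as `S₊ ∪ S₋` with `S₊, S₋`
factorial, `S₊ ∩ S₋ = {ε}`, and `x ∈ S₋ ↔ x⁻¹ ∈ S₊`. -/
def OrientableSet {A : Type*} (S : Set (List (Letter A))) : Prop :=
  ∃ Sp Sm : Set (List (Letter A)), FactorialSet Sp ∧ FactorialSet Sm ∧
    S = Sp ∪ Sm ∧ Sp ∩ Sm = {([] : List (Letter A))} ∧
    ∀ x ∈ S, (x ∈ Sm ↔ wordInv x ∈ Sp)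

/-- A set of words is uniformly recurrent if it is right extendable and every
`u ∈ S` occurs in every long enough word of `S`. -/
def UniformlyRecurrent {α : Type*} (S : Set (List α)) : Prop :=
  (∀ u ∈ S, ∃ c : α, u ++ [c] ∈ S) ∧
  ∀ u ∈ S, ∃ n : ℕ, 1 ≤ n ∧ ∀ w ∈ S, w.length = n → u <:+: w

/-- A set of words over `A ∪ A⁻¹` is uniformly semi-recurrent if it is right
extendable and for every `u ∈ S`, every long enough word of `S` contains `u` or
`u⁻¹` as a factor. -/
def UniformlySemiRecurrent {A : Type*} (S : Set (List (Letter A))) : Prop :=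
  (∀ u ∈ S, ∃ c : Letter A, u ++ [c] ∈ S) ∧
  ∀ u ∈ S, ∃ n : ℕ, 1 ≤ n ∧ ∀ w ∈ S, w.length = n → (u <:+: w ∨ wordInv u <:+: w)

/-- A laminary set is semi-recurrent if for all `u, w ∈ S` there is `v ∈ S`
with `uvw ∈ S` or `uvw⁻¹ ∈ S`. -/
def SemiRecurrent {A : Type*} (S : Set (List (Letter A))) : Prop :=
  ∀ u ∈ S, ∀ w ∈ S, ∃ v ∈ S, u ++ v ++ w ∈ S ∨ u ++ v ++ wordInv w ∈ S

/-- A complete return word to `X ⊆ S`: a word of `S` with a proper prefix in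
`X` and a proper suffix in `X`. -/
def CompleteReturnWord {α : Type*} (S X : Set (List α)) (u : List α) : Prop :=
  u ∈ S ∧ (∃ p ∈ X, p <+: u ∧ p ≠ u) ∧ (∃ s ∈ X, s <:+ u ∧ s ≠ u)

/-- A complete first return word to `X`: a complete return word to `X` with no
internal factor in `X`. -/
def CompleteFirstReturnWord {α : Type*} (S X : Set (List α)) (u : List α) : Prop :=
  CompleteReturnWord S X u ∧
    ¬ ∃ p v s : List α, u = p ++ v ++ s ∧ v ∈ X ∧ p ≠ [] ∧ s ≠ []

/-- `CR S w`: the set of complete first return words to `{w, w⁻¹}` in `S`. -/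
def CR {A : Type*} (S : Set (List (Letter A))) (w : List (Letter A)) :
    Set (List (Letter A)) :=
  {u | CompleteFirstReturnWord S {w, wordInv w} u}

open Classical in
/-- The operation `N` on complete return words to `{w, w⁻¹}`: erase the prefix
`w` if present, and erase the suffix `w⁻¹` if present. -/
noncomputable def NN {A : Type*} (w u : List (Letter A)) : List (Letter A) :=
  let u' := if w <+: u then u.drop w.length else u
  if wordInv w <:+ u' then u'.take (u'.length - w.length) else u'

/-- `MR S w`: the set of mixed first return words to `w` in `S`. -/
noncomputable def MR {A : Type*} (S : Set (List (Letter A))) (w : List (Letter A)) :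
    Set (List (Letter A)) :=
  NN w '' CR S w

/-- `RightReturn S w`: the set of first right return words to `w` in `S`,
i.e. the words `u` such that `wu` is a complete first return word to `{w}`. -/
def RightReturn {α : Type*} (S : Set (List α)) (w : List α) : Set (List α) :=
  {u | CompleteFirstReturnWord S {w} (w ++ u)}

/-- `X` is a basis (free generating set) of the subgroup `H`: the canonical map
`FreeGroup X → G` is injective with range `H`. -/
def IsBasisOf {G : Type*} [Group G] (X : Set G) (H : Subgroup G) : Prop :=
  Function.Injective (FreeGroup.lift (fun x : X => (x : G))) ∧
    (FreeGroup.lift (fun x : X => (x : G)) : FreeGroup X →* G).range = H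

/-- `Y` is a symmetric basis of `H` if `Y = X ∪ X⁻¹` for some basis `X` of `H`. -/
def IsSymmetricBasisOf {G : Type*} [Group G] (Y : Set G) (H : Subgroup G) : Prop :=
  ∃ X : Set G, IsBasisOf X H ∧ Y = X ∪ X⁻¹

/-- The prime words in `S` with respect to a subgroup `G` of `F_A`: the
nonempty words of `G ∩ S` without a proper nonempty prefix in `G ∩ S`. -/
def PrimeWords {A : Type*} (S : Set (List (Letter A))) (G : Subgroup (FreeGroup A)) :
    Set (List (Letter A)) :=
  {u | u ∈ S ∧ u ≠ [] ∧ FreeGroup.mk u ∈ G ∧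
    ∀ p : List (Letter A), p <+: u → p ≠ [] → p ≠ u → ¬(p ∈ S ∧ FreeGroup.mk p ∈ G)}

@[simp] lemma Letter.inv_inv {A : Type*} (c : Letter A) : Letter.inv (Letter.inv c) = c := by
  simp [Letter.inv]

lemma Letter.inv_ne {A : Type*} (c : Letter A) : Letter.inv c ≠ c := by
  intro h
  have := congrArg Prod.snd h
  simp [Letter.inv] at this

@[simp] lemma s2_s2 (z : ℝ × Bool) : s2 (s2 z) = z := by simp [s2]

lemma continuous_s2 : Continuous s2 :=
  continuous_fst.prodMk ((continuous_of_discreteTopology (f := not)).comp continuous_snd)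

/-- Two nonempty open intervals that coincide have the same endpoints. -/
lemma Ioo_endpoints_eq {a b c d : ℝ} (hab : a < b) (hcd : c < d) (h : Ioo a b = Ioo c d) :
    a = c ∧ b = d := by
  constructor
  · rw [← csInf_Ioo hab, h, csInf_Ioo hcd]
  · rw [← csSup_Ioo hab, h, csSup_Ioo hcd]

/-- Every point of an open set of `ℝ × Bool` is surrounded by an interval of the set. -/
lemma exists_interval_subset {V : Set (ℝ × Bool)} (hV : IsOpen V) {x : ℝ × Bool} (hx : x ∈ V) :
    ∃ ε > 0, ∀ t : ℝ, |t| < ε → (x.1 + t, x.2) ∈ V := by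
  have hc : Continuous fun t : ℝ => ((x.1 + t, x.2) : ℝ × Bool) := by fun_prop
  obtain ⟨ε, hε, h⟩ := Metric.isOpen_iff.1 (hV.preimage hc) 0 (by simpa using hx)
  exact ⟨ε, hε, fun t ht => h (by simpa using ht)⟩

/-- A subset of `ℝ × Bool` is open if every point is surrounded by an interval of the set. -/
lemma isOpen_of_intervals {V : Set (ℝ × Bool)}
    (h : ∀ x ∈ V, ∃ ε > 0, ∀ t : ℝ, |t| < ε → (x.1 + t, x.2) ∈ V) : IsOpen V := by
  rw [isOpen_iff_forall_mem_open]
  intro x hx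
  obtain ⟨ε, hε, h⟩ := h x hx
  refine ⟨Ioo (x.1 - ε) (x.1 + ε) ×ˢ {x.2}, ?_, isOpen_Ioo.prod (isOpen_discrete _), ?_⟩
  · rintro ⟨y, d⟩ ⟨⟨h1, h2⟩, h3⟩
    simp only [mem_singleton_iff] at h1 h2 h3
    subst h3
    have := h (y - x.1) (by rw [abs_lt]; constructor <;> linarith)
    simpa using this
  · exact ⟨⟨by linarith, by linarith⟩, rfl⟩

namespace LinearInvolution

variable {A : Type*} [Fintype A] (L : LinearInvolution A)

/-- The points at which `T` is a local isometry. -/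
def regularSet : Set (ℝ × Bool) := L.Ihat \ L.Sig

/-- The points whose whole forward orbit avoids the singularities of `T`. -/
def forwardRegular : Set (ℝ × Bool) := {z | ∀ k, L.T^[k] z ∈ L.regularSet}

/-- The periodic points with a regular orbit. -/
def periodicSet : Set (ℝ × Bool) := {z | z ∈ L.forwardRegular ∧ ∃ n, 0 < n ∧ L.T^[n] z = z}

/-- An open subset of `Î` invariant under `T` and its inverse. -/
structure IsOpenInvariant (V : Set (ℝ × Bool)) : Prop where
  subset : V ⊆ L.Ihat
  isOpen : IsOpen V
  invariant : ∀ x ∈ L.regularSet, L.T x ∈ V ↔ x ∈ V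

lemma mem_Ia {c : Letter A} {z : ℝ × Bool} :
    z ∈ L.Ia c ↔ (L.endLo c < z.1 ∧ z.1 < L.endHi c) ∧ z.2 = L.comp c := by
  simp [Ia, mem_prod]

lemma mem_Ihat {z : ℝ × Bool} : z ∈ L.Ihat ↔ L.lo < z.1 ∧ z.1 < L.hi := by
  simp [Ihat, mem_prod]

lemma s2_mem_Ihat {z : ℝ × Bool} : s2 z ∈ L.Ihat ↔ z ∈ L.Ihat := by
  simp [mem_Ihat, s2]

lemma mem_regularSet {z : ℝ × Bool} : z ∈ L.regularSet ↔ ∃ c, z ∈ L.Ia c := by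
  constructor
  · rintro ⟨h1, h2⟩
    have h3 : z ∈ (⋃ c : Letter A, L.Ia c) ∪ L.Sig := L.cover.le h1
    rcases h3 with h3 | h3
    · exact mem_iUnion.1 h3
    · exact absurd h3 h2
  · rintro ⟨c, hc⟩
    refine ⟨?_, fun h => (Set.disjoint_left.1 (L.Sig_disj c)) h hc⟩
    have h3 : z ∈ (⋃ c : Letter A, L.Ia c) ∪ L.Sig := Or.inl (mem_iUnion.2 ⟨c, hc⟩)
    exact L.cover.ge h3

lemma letter_unique {c d : Letter A} {z : ℝ × Bool} (hc : z ∈ L.Ia c) (hd : z ∈ L.Ia d) :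
    c = d := by
  by_contra h
  exact Set.disjoint_left.1 (L.disj c d h) hc hd

lemma isOpen_Ia (c : Letter A) : IsOpen (L.Ia c) := isOpen_Ioo.prod (isOpen_discrete _)

lemma isOpen_Ihat : IsOpen L.Ihat := isOpen_Ioo.prod isOpen_univ

lemma isOpen_regularSet : IsOpen L.regularSet := by
  have : L.regularSet = ⋃ c, L.Ia c := by
    ext z
    simp [mem_regularSet]
  rw [this]
  exact isOpen_iUnion L.isOpen_Ia

lemma s1_mem_Ia {c : Letter A} {z : ℝ × Bool} (hz : z ∈ L.Ia c) :
    L.s1 z ∈ L.Ia (Letter.inv c) := by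
  have := L.s1_image c
  have h : L.s1 z ∈ L.s1 '' (L.Ia c) := mem_image_of_mem _ hz
  unfold Ia at h ⊢
  rwa [this] at h

lemma s1_s1 {z : ℝ × Bool} (hz : z ∈ L.regularSet) : L.s1 (L.s1 z) = z := L.s1_invol z hz

lemma s1_mem_regularSet {z : ℝ × Bool} (hz : z ∈ L.regularSet) : L.s1 z ∈ L.regularSet := by
  obtain ⟨c, hc⟩ := L.mem_regularSet.1 hz
  exact L.mem_regularSet.2 ⟨_, L.s1_mem_Ia hc⟩

lemma s2_T (z : ℝ × Bool) : s2 (L.T z) = L.s1 z := by simp [T]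

lemma s2_T_mem_regularSet {z : ℝ × Bool} (hz : z ∈ L.regularSet) :
    s2 (L.T z) ∈ L.regularSet := by
  rw [s2_T]
  exact L.s1_mem_regularSet hz

lemma T_mem_Ihat {z : ℝ × Bool} (hz : z ∈ L.regularSet) : L.T z ∈ L.Ihat :=
  L.s2_mem_Ihat.1 (L.s2_T_mem_regularSet hz).1

lemma T_s2_T {z : ℝ × Bool} (hz : z ∈ L.regularSet) : L.T (s2 (L.T z)) = s2 z := by
  rw [s2_T, T, L.s1_s1 hz]

lemma T_injOn : InjOn L.T L.regularSet := by
  intro x hx y hy h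
  have := L.T_s2_T hx
  rw [h, L.T_s2_T hy] at this
  rw [← s2_s2 x, ← this, s2_s2]

/-- On `I_c`, the map `T` is the translation or the symmetry determined by the endpoints. -/
lemma T_formula (c : Letter A) :
    (∀ z ∈ L.Ia c, L.T z = (L.endLo (Letter.inv c) + (z.1 - L.endLo c),
      !L.comp (Letter.inv c))) ∨
    (∀ z ∈ L.Ia c, L.T z = (L.endHi (Letter.inv c) - (z.1 - L.endLo c),
      !L.comp (Letter.inv c))) := by
  have him := L.s1_image c
  have hlt := L.end_lt c
  rcases L.s1_iso c with ⟨α, h⟩ | ⟨α, h⟩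
  · left
    have key : Ioo (L.endLo c + α) (L.endHi c + α)
        = Ioo (L.endLo (Letter.inv c)) (L.endHi (Letter.inv c)) := by
      ext x
      have hx : x ∈ Ioo (L.endLo (Letter.inv c)) (L.endHi (Letter.inv c)) ↔
          (x, L.comp (Letter.inv c)) ∈ L.Ia (Letter.inv c) := by simp [mem_Ia]
      rw [hx, Ia, ← him]
      constructor
      · intro hx
        have hm : ((x - α, L.comp c) : ℝ × Bool) ∈
            Ioo (L.endLo c) (L.endHi c) ×ˢ ({L.comp c} : Set Bool) :=
          ⟨⟨by linarith [hx.1], by linarith [hx.2]⟩, rfl⟩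
        exact ⟨_, hm, by rw [h _ hm]; simp⟩
      · rintro ⟨y, hy, hyx⟩
        rw [h y hy] at hyx
        have h1 := congrArg Prod.fst hyx
        simp only at h1
        have h2 := hy.1.1
        have h3 := hy.1.2
        constructor <;> linarith
    obtain ⟨h1, -⟩ := Ioo_endpoints_eq (by linarith) (L.end_lt _) key
    intro z hz
    rw [T, h z hz, ← h1]
    ext <;> simp [s2]
    ring
  · right
    have key : Ioo (α - L.endHi c) (α - L.endLo c)
        = Ioo (L.endLo (Letter.inv c)) (L.endHi (Letter.inv c)) := by
      ext x
      have hx : x ∈ Ioo (L.endLo (Letter.inv c)) (L.endHi (Letter.inv c)) ↔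
          (x, L.comp (Letter.inv c)) ∈ L.Ia (Letter.inv c) := by simp [mem_Ia]
      rw [hx, Ia, ← him]
      constructor
      · intro hx
        have hm : ((α - x, L.comp c) : ℝ × Bool) ∈
            Ioo (L.endLo c) (L.endHi c) ×ˢ ({L.comp c} : Set Bool) :=
          ⟨⟨by linarith [hx.2], by linarith [hx.1]⟩, rfl⟩
        exact ⟨_, hm, by rw [h _ hm]; simp⟩
      · rintro ⟨y, hy, hyx⟩
        rw [h y hy] at hyx
        have h1 := congrArg Prod.fst hyx
        simp only at h1
        have h2 := hy.1.1
        have h3 := hy.1.2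
        constructor <;> linarith
    obtain ⟨-, h1⟩ := Ioo_endpoints_eq (by linarith) (L.end_lt _) key
    intro z hz
    rw [T, h z hz, ← h1]
    ext <;> simp [s2]
    ring

/-- On each `I_c`, the map `T` is an isometry. -/
lemma T_isometry (c : Letter A) : ∃ s : ℝ, (s = 1 ∨ s = -1) ∧ ∀ x ∈ L.Ia c, ∀ y ∈ L.Ia c,
    L.T y = ((L.T x).1 + s * (y.1 - x.1), (L.T x).2) := by
  rcases L.T_formula c with h | h
  · refine ⟨1, Or.inl rfl, fun x hx y hy => ?_⟩
    rw [h x hx, h y hy]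
    ext <;> simp
    ring
  · refine ⟨-1, Or.inr rfl, fun x hx y hy => ?_⟩
    rw [h x hx, h y hy]
    ext <;> simp
    ring

lemma continuousOn_T : ContinuousOn L.T L.regularSet := by
  intro x hx
  obtain ⟨c, hc⟩ := L.mem_regularSet.1 hx
  obtain ⟨s, -, h⟩ := L.T_isometry c
  have hcont : Continuous fun y : ℝ × Bool => ((L.T x).1 + s * (y.1 - x.1), (L.T x).2) := by
    fun_prop
  refine (hcont.continuousAt.congr ?_).continuousWithinAt
  filter_upwards [(L.isOpen_Ia c).mem_nhds hc] with y hy using (h x hc y hy).symm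

lemma isOpen_preimage_T {V : Set (ℝ × Bool)} (hV : IsOpen V) :
    IsOpen (L.regularSet ∩ L.T ⁻¹' V) :=
  L.continuousOn_T.isOpen_inter_preimage L.isOpen_regularSet hV

/-- Points joined by a segment without singularity lie in the same interval `I_c`. -/
lemma mem_Ia_of_segment {c : Letter A} {x y : ℝ × Bool} (hx : x ∈ L.Ia c) (hxy : y.2 = x.2)
    (h : ∀ r ∈ uIcc x.1 y.1, (r, x.2) ∈ L.regularSet) : y ∈ L.Ia c := by
  have hS : IsPreconnected ((fun r : ℝ => ((r, x.2) : ℝ × Bool)) '' uIcc x.1 y.1) :=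
    isPreconnected_uIcc.image _ (by fun_prop)
  by_contra hy
  have ho : IsOpen (⋃ d ∈ {d | d ≠ c}, L.Ia d) :=
    isOpen_biUnion fun d _ => L.isOpen_Ia d
  obtain ⟨z, -, hz1, hz2⟩ := hS _ _ (L.isOpen_Ia c) ho (by
    rintro _ ⟨r, hr, rfl⟩
    obtain ⟨d, hd⟩ := L.mem_regularSet.1 (h r hr)
    by_cases hdc : d = c
    · exact Or.inl (hdc ▸ hd)
    · exact Or.inr (mem_iUnion₂.2 ⟨d, hdc, hd⟩)) ⟨x, ⟨x.1, left_mem_uIcc, rfl⟩, hx⟩ (by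
    have hyx : ((y.1, x.2) : ℝ × Bool) = y := by rw [← hxy]
    obtain ⟨d, hd⟩ := L.mem_regularSet.1 (h y.1 right_mem_uIcc)
    refine ⟨_, ⟨y.1, right_mem_uIcc, rfl⟩, mem_iUnion₂.2 ⟨d, ?_, hd⟩⟩
    rintro rfl
    exact hy (hyx ▸ hd))
  obtain ⟨d, hdc, hd⟩ := mem_iUnion₂.1 hz2
  exact hdc (L.letter_unique hd hz1)

lemma T_iterate_succ (n : ℕ) (z : ℝ × Bool) : L.T^[n + 1] z = L.T (L.T^[n] z) :=
  Function.iterate_succ_apply' _ _ _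

lemma forwardRegular_iterate {z : ℝ × Bool} (hz : z ∈ L.forwardRegular) (n : ℕ) :
    L.T^[n] z ∈ L.forwardRegular := by
  intro k
  rw [← Function.iterate_add_apply]
  exact hz _

lemma forwardRegular_of_forall_notMem_Sig {z : ℝ × Bool} (hz : z ∈ L.Ihat)
    (h : ∀ k, L.T^[k] z ∉ L.Sig) : z ∈ L.forwardRegular := by
  intro k
  induction k with
  | zero => exact ⟨hz, h 0⟩
  | succ k ih =>
    refine ⟨?_, h _⟩
    rw [T_iterate_succ]
    exact L.T_mem_Ihat ih

lemma iterate_injective {x y : ℝ × Bool} {n : ℕ} (hx : ∀ k < n, L.T^[k] x ∈ L.regularSet)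
    (hy : ∀ k < n, L.T^[k] y ∈ L.regularSet) (h : L.T^[n] x = L.T^[n] y) : x = y := by
  induction n with
  | zero => exact h
  | succ n ih =>
    refine ih (fun k hk => hx k (by omega)) (fun k hk => hy k (by omega)) ?_
    rw [T_iterate_succ, T_iterate_succ] at h
    exact L.T_injOn (hx n (by omega)) (hy n (by omega)) h

/-- Reversing an orbit segment. -/
lemma iterate_s2_iterate {z : ℝ × Bool} {n : ℕ} (hz : ∀ k < n, L.T^[k] z ∈ L.regularSet) :
    ∀ j ≤ n, L.T^[j] (s2 (L.T^[n] z)) = s2 (L.T^[n - j] z) := by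
  intro j
  induction j with
  | zero => simp
  | succ j ih =>
    intro hj
    rw [T_iterate_succ, ih (by omega), show n - j = (n - (j + 1)) + 1 by omega, T_iterate_succ,
      L.T_s2_T (hz _ (by omega))]

/-- A sequence of points of `Î` decorated with signs has two terms close to each other. -/
lemma exists_close {p : ℕ → ℝ × Bool} (hp : ∀ n, p n ∈ L.Ihat) {s : ℕ → ℝ}
    (hs : ∀ n, s n = 1 ∨ s n = -1) {ε : ℝ} (hε : 0 < ε) :
    ∃ n m, n < m ∧ |(p n).1 - (p m).1| < ε ∧ (p n).2 = (p m).2 ∧ s n = s m := by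
  have hfin : (Icc ⌊L.lo / ε⌋ ⌊L.hi / ε⌋ ×ˢ ((univ : Set Bool) ×ˢ ({1, -1} : Set ℝ))).Finite :=
    (finite_Icc _ _).prod (finite_univ.prod (by simp))
  obtain ⟨n, -, m, -, hnm, h⟩ := (infinite_univ (α := ℕ)).exists_ne_map_eq_of_mapsTo
    (f := fun n => (⌊(p n).1 / ε⌋, (p n).2, s n)) (fun n _ => by
      have h := L.mem_Ihat.1 (hp n)
      refine ⟨⟨Int.floor_le_floor ?_, Int.floor_le_floor ?_⟩, mem_univ _, by simpa using hs n⟩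
      · exact div_le_div_of_nonneg_right h.1.le hε.le
      · exact div_le_div_of_nonneg_right h.2.le hε.le) hfin
  simp only [Prod.mk.injEq] at h
  have h1 := Int.abs_sub_lt_one_of_floor_eq_floor h.1
  rw [← sub_div, abs_div, abs_of_pos hε, div_lt_one hε] at h1
  rcases lt_or_gt_of_ne hnm with hlt | hlt
  · exact ⟨n, m, hlt, h1, h.2⟩
  · exact ⟨m, n, hlt, by rwa [abs_sub_comm], h.2.1.symm, h.2.2.symm⟩

lemma exists_of_mem_uIcc_add {a s t r : ℝ} (hs : s = 1 ∨ s = -1) (hr : r ∈ uIcc a (a + s * t)) :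
    ∃ t' ∈ uIcc 0 t, r = a + s * t' := by
  refine ⟨s * (r - a), ?_, by rcases hs with rfl | rfl <;> ring⟩
  rw [mem_uIcc] at hr ⊢
  rcases hs with rfl | rfl <;> rcases hr with hr | hr
  · left; constructor <;> linarith
  · right; constructor <;> linarith
  · right; constructor <;> linarith
  · left; constructor <;> linarith

lemma abs_lt_of_mem_uIcc_zero {t t' ε : ℝ} (h : t' ∈ uIcc 0 t) (ht : |t| < ε) : |t'| < ε := by
  rw [mem_uIcc] at h
  rw [abs_lt] at ht ⊢
  rcases h with h | h <;> constructor <;> linarith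

/-- The iterates of `T` are isometries on intervals whose orbit meets no singularity. -/
lemma iterate_isometry {x : ℝ × Bool} {ε : ℝ} (hε : 0 < ε) (n : ℕ)
    (h : ∀ t, |t| < ε → ∀ k < n, L.T^[k] (x.1 + t, x.2) ∈ L.regularSet) :
    ∃ s : ℝ, (s = 1 ∨ s = -1) ∧ ∀ t, |t| < ε →
      L.T^[n] (x.1 + t, x.2) = ((L.T^[n] x).1 + s * t, (L.T^[n] x).2) := by
  induction n with
  | zero => exact ⟨1, Or.inl rfl, fun t _ => by simp⟩
  | succ n ih =>
    obtain ⟨s, hs, hst⟩ := ih fun t ht k hk => h t ht k (by omega)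
    have hreg : ∀ t, |t| < ε → ((L.T^[n] x).1 + s * t, (L.T^[n] x).2) ∈ L.regularSet := by
      intro t ht
      rw [← hst t ht]
      exact h t ht n (by omega)
    obtain ⟨c, hc⟩ := L.mem_regularSet.1 (hreg 0 (by simpa using hε))
    simp only [mul_zero, add_zero, Prod.mk.eta] at hc
    obtain ⟨s', hs', hT⟩ := L.T_isometry c
    refine ⟨s' * s, by rcases hs with rfl | rfl <;> rcases hs' with rfl | rfl <;> simp, ?_⟩
    intro t ht
    have hmem : ((L.T^[n] x).1 + s * t, (L.T^[n] x).2) ∈ L.Ia c := by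
      refine L.mem_Ia_of_segment hc rfl fun r hr => ?_
      obtain ⟨t', ht', rfl⟩ := exists_of_mem_uIcc_add hs hr
      exact hreg t' (abs_lt_of_mem_uIcc_zero ht' ht)
    rw [T_iterate_succ, hst t ht, hT _ hc _ hmem, T_iterate_succ]
    ext <;> simp
    ring

lemma isOpen_regular_iterates (n : ℕ) : IsOpen {x | ∀ k < n, L.T^[k] x ∈ L.regularSet} := by
  induction n with
  | zero => simp
  | succ n ih =>
    convert L.isOpen_preimage_T ih using 1
    ext x
    constructor
    · intro h
      exact ⟨h 0 (by omega), fun k hk => h (k + 1) (by omega)⟩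
    · rintro ⟨h1, h2⟩ k hk
      cases k with
      | zero => exact h1
      | succ k => exact h2 k (by omega)

/-- Without connection, there are finitely many singularities. -/
lemma finite_Sig (hnc : ¬ L.HasConnection) : L.Sig.Finite := by
  set E : Set ℝ := range L.endLo ∪ range L.endHi with hE
  have hEfin : E.Finite := (finite_range _).union (finite_range _)
  refine (hEfin.prod (finite_univ (α := Bool))).subset fun x hx => ?_
  by_contra hxE
  have hxE' : x.1 ∉ E := fun h => hxE ⟨h, mem_univ _⟩
  have hxI : x ∈ L.Ihat := L.Sig_sub hx
  have hopen : IsOpen (Eᶜ ∩ Ioo L.lo L.hi) := hEfin.isClosed.isOpen_compl.inter isOpen_Ioo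
  obtain ⟨ε, hε, hball⟩ := Metric.isOpen_iff.1 hopen x.1 ⟨hxE', hxI.1⟩
  have hSig : ∀ t, |t| < ε → (x.1 + t, x.2) ∈ L.Sig := by
    intro t ht
    have h1 : ∀ t', |t'| < ε → x.1 + t' ∈ Eᶜ ∩ Ioo L.lo L.hi := fun t' ht' =>
      hball (by simpa using ht')
    by_contra hns
    obtain ⟨c, hc⟩ := L.mem_regularSet.1
      (show (x.1 + t, x.2) ∈ L.regularSet from ⟨⟨(h1 t ht).2, mem_univ _⟩, hns⟩)
    obtain ⟨⟨hc1, hc2⟩, hc3⟩ := L.mem_Ia.1 hc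
    simp only at hc1 hc2 hc3
    refine Set.disjoint_left.1 (L.Sig_disj c) hx ⟨⟨?_, ?_⟩, hc3⟩
    · by_contra hle
      refine (h1 (L.endLo c - x.1) ?_).1 (Or.inl ⟨c, by ring⟩)
      rw [abs_lt] at ht ⊢
      constructor <;> linarith
    · by_contra hle
      refine (h1 (L.endHi c - x.1) ?_).1 (Or.inr ⟨c, by ring⟩)
      rw [abs_lt] at ht ⊢
      constructor <;> linarith
  have hreg : ∀ t, |t| < ε → ((s2 x).1 + t, (s2 x).2) ∈ L.forwardRegular := by
    intro t ht
    refine L.forwardRegular_of_forall_notMem_Sig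
      (L.s2_mem_Ihat.2 (L.Sig_sub (hSig t ht))) fun k hk => hnc ?_
    exact ⟨_, ⟨_, hSig t ht, rfl⟩, k, hk⟩
  choose s hs hst using fun n => L.iterate_isometry hε n fun t ht k _ => hreg t ht k
  have hreg0 : s2 x ∈ L.forwardRegular := by simpa using hreg 0 (by simpa using hε)
  obtain ⟨n, m, hnm, hd, hcomp, -⟩ :=
    L.exists_close (p := fun n => L.T^[n] (s2 x)) (fun n => (hreg0 n).1) hs hε
  set t := s n * ((L.T^[m] (s2 x)).1 - (L.T^[n] (s2 x)).1) with ht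
  have htε : |t| < ε := by
    rw [ht, abs_mul, abs_sub_comm]
    rcases hs n with h | h <;> rw [h] <;> simpa using hd
  have heq : L.T^[n] ((s2 x).1 + t, (s2 x).2) = L.T^[n] (L.T^[m - n] (s2 x)) := by
    rw [hst n t htε, ← Function.iterate_add_apply, show n + (m - n) = m by omega]
    ext
    · rw [ht, ← mul_assoc]
      rcases hs n with h | h <;> rw [h] <;> simp
    · simp [hcomp]
  have heq' := L.iterate_injective (fun k _ => hreg t htε k)
    (fun k _ => L.forwardRegular_iterate hreg0 (m - n) k) heq
  obtain ⟨j, hj⟩ : ∃ j, m - n = j + 1 := ⟨m - n - 1, by omega⟩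
  rw [hj, T_iterate_succ] at heq'
  have h2 := (L.s2_T_mem_regularSet (hreg0 j)).2
  rw [← heq'] at h2
  exact h2 (by simpa [s2] using hSig t htε)

/-- A one-sided neighbourhood inside an invariant open set is mapped to another one. -/
lemma exists_segment_image {V : Set (ℝ × Bool)} (hV : L.IsOpenInvariant V) {p : ℝ × Bool}
    (hp : p ∈ L.regularSet) {s ℓ : ℝ} (hs : s = 1 ∨ s = -1)
    (hseg : ∀ t, 0 < t → t < ℓ → (p.1 + s * t, p.2) ∈ V \ L.Sig) :
    ∃ s' : ℝ, (s' = 1 ∨ s' = -1) ∧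
      ∀ t, 0 < t → t < ℓ → ((L.T p).1 + s' * t, (L.T p).2) ∈ V := by
  obtain ⟨c, hc⟩ := L.mem_regularSet.1 hp
  obtain ⟨s₀, hs₀, hT⟩ := L.T_isometry c
  refine ⟨s₀ * s, by rcases hs with rfl | rfl <;> rcases hs₀ with rfl | rfl <;> simp, ?_⟩
  intro t ht htℓ
  have hreg : ∀ t, 0 < t → t < ℓ → (p.1 + s * t, p.2) ∈ L.regularSet := fun t h1 h2 =>
    ⟨hV.subset (hseg t h1 h2).1, (hseg t h1 h2).2⟩
  have hmem : (p.1 + s * t, p.2) ∈ L.Ia c := by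
    refine L.mem_Ia_of_segment hc rfl fun r hr => ?_
    obtain ⟨t', ht', rfl⟩ := exists_of_mem_uIcc_add hs hr
    rw [uIcc_of_le ht.le] at ht'
    rcases ht'.1.eq_or_lt with rfl | h
    · simpa using hp
    · exact hreg t' h (ht'.2.trans_lt htℓ)
  have h1 := (hV.invariant _ (hreg t ht htℓ)).2 (hseg t ht htℓ).1
  rw [hT p hc _ hmem] at h1
  convert h1 using 2
  simp
  ring

/-- A forward regular endpoint of an invariant open set is periodic. -/
lemma exists_iterate_eq_of_endpoint (hfin : L.Sig.Finite) {V : Set (ℝ × Bool)}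
    (hV : L.IsOpenInvariant V) {b : ℝ × Bool} (hb : b ∈ L.forwardRegular) (hbV : b ∉ V)
    {s ε : ℝ} (hs : s = 1 ∨ s = -1) (hε : 0 < ε)
    (hseg : ∀ t, 0 < t → t < ε → (b.1 + s * t, b.2) ∈ V) : ∃ n, 0 < n ∧ L.T^[n] b = b := by
  by_contra hper
  have hinj : ∀ n m, L.T^[n] b = L.T^[m] b → n = m := by
    have key : ∀ n m, n < m → L.T^[n] b ≠ L.T^[m] b := by
      intro n m hnm h
      refine hper ⟨m - n, by omega, ?_⟩
      rw [show m = n + (m - n) by omega, Function.iterate_add_apply] at h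
      exact (L.iterate_injective (fun k _ => hb k)
        (fun k _ => L.forwardRegular_iterate hb (m - n) k) h).symm
    intro n m h
    rcases lt_trichotomy n m with h1 | h1 | h1
    · exact absurd h (key _ _ h1)
    · exact h1
    · exact absurd h.symm (key _ _ h1)
  have hnV : ∀ n, L.T^[n] b ∉ V := by
    intro n
    induction n with
    | zero => exact hbV
    | succ n ih =>
      rw [T_iterate_succ, hV.invariant _ (hb n)]
      exact ih
  have hexists : ∀ n, ∃ ℓ > 0, ∃ s : ℝ, (s = 1 ∨ s = -1) ∧
      ∀ t, 0 < t → t < ℓ → ((L.T^[n] b).1 + s * t, (L.T^[n] b).2) ∈ V := by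
    intro n
    induction n with
    | zero => exact ⟨ε, hε, s, hs, hseg⟩
    | succ n ih =>
      obtain ⟨ℓ, hℓ, s, hs, h⟩ := ih
      obtain ⟨η, hη, hreg⟩ := exists_interval_subset L.isOpen_regularSet (hb n)
      obtain ⟨s', hs', h'⟩ := L.exists_segment_image hV (hb n) (ℓ := min ℓ η) hs
        fun t ht htℓ => ⟨h t ht (htℓ.trans_le (min_le_left _ _)), (hreg (s * t) (by
          rw [abs_mul, abs_of_pos ht]
          rcases hs with rfl | rfl <;> simpa using htℓ.trans_le (min_le_right _ _))).2⟩
      rw [T_iterate_succ]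
      exact ⟨_, lt_min hℓ hη, s', hs', h'⟩
  set B : Set ℕ := {n | ∃ s : ℝ, (s = 1 ∨ s = -1) ∧ ∃ t > 0,
    ((L.T^[n] b).1 + s * t, (L.T^[n] b).2) ∈ L.Sig ∧
    ∀ t', 0 < t' → t' ≤ t → ((L.T^[n] b).1 + s * t', (L.T^[n] b).2) ∈ V} with hB
  have hBfin : B.Finite := by
    have hsub : B ⊆ ⋃ σ ∈ L.Sig, ⋃ s ∈ ({1, -1} : Set ℝ), {n | ∃ t > 0,
        ((L.T^[n] b).1 + s * t, (L.T^[n] b).2) = σ ∧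
        ∀ t', 0 < t' → t' ≤ t → ((L.T^[n] b).1 + s * t', (L.T^[n] b).2) ∈ V} := by
      rintro n ⟨s, hs, t, ht, h1, h2⟩
      simp only [mem_iUnion]
      exact ⟨_, h1, s, by simpa using hs, t, ht, rfl, h2⟩
    refine (hfin.biUnion fun σ _ => (Set.toFinite _).biUnion fun s _ => ?_).subset hsub
    have key : ∀ n m, ∀ t > 0, ∀ u > 0, ((L.T^[n] b).1 + s * t, (L.T^[n] b).2) =
        ((L.T^[m] b).1 + s * u, (L.T^[m] b).2) →
        (∀ t', 0 < t' → t' ≤ u → ((L.T^[m] b).1 + s * t', (L.T^[m] b).2) ∈ V) → u ≤ t := by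
      intro n m t ht u hu h hu'
      by_contra hlt
      refine hnV n ?_
      convert hu' (u - t) (by linarith) (by linarith) using 1
      simp only [Prod.mk.injEq] at h
      ext
      · simp only
        linarith
      · simp [h.2]
    refine Set.Subsingleton.finite ?_
    rintro n ⟨t, ht, h1, h2⟩ m ⟨u, hu, h3, h4⟩
    have h5 := key n m t ht u hu (h1.trans h3.symm) h4
    have h6 := key m n u hu t ht (h3.trans h1.symm) h2
    obtain rfl : t = u := le_antisymm h6 h5
    refine hinj _ _ ?_
    have h7 := h1.trans h3.symm
    simp only [Prod.mk.injEq, add_left_inj] at h7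
    exact Prod.ext h7.1 h7.2
  obtain ⟨N, hN⟩ := hBfin.bddAbove
  obtain ⟨ℓ, hℓ, s₀, hs₀, hN₀⟩ := hexists (N + 1)
  have huniform : ∀ k, ∃ s : ℝ, (s = 1 ∨ s = -1) ∧
      ∀ t, 0 < t → t < ℓ → ((L.T^[N + 1 + k] b).1 + s * t, (L.T^[N + 1 + k] b).2) ∈ V := by
    intro k
    induction k with
    | zero => exact ⟨s₀, hs₀, hN₀⟩
    | succ k ih =>
      obtain ⟨s, hs, h⟩ := ih
      rw [← add_assoc, T_iterate_succ]
      refine L.exists_segment_image hV (hb _) hs fun t ht htℓ => ⟨h t ht htℓ, fun hS => ?_⟩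
      have : N + 1 + k ∈ B :=
        ⟨s, hs, t, ht, hS, fun t' h1 h2 => h t' h1 (h2.trans_lt htℓ)⟩
      have := hN this
      omega
  choose σ hσ hσV using huniform
  obtain ⟨n, m, hnm, hd, hcomp, hsgn⟩ :=
    L.exists_close (p := fun k => L.T^[N + 1 + k] b) (fun k => (hb _).1) hσ hℓ
  have hne : (L.T^[N + 1 + n] b).1 ≠ (L.T^[N + 1 + m] b).1 := by
    intro h
    have := hinj _ _ (Prod.ext h hcomp)
    omega
  have hn := hnV (N + 1 + n)
  have hm := hnV (N + 1 + m)
  have hVn := hσV n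
  have hVm := hσV m
  have hσn := hσ n
  rw [← hsgn] at hVm
  generalize L.T^[N + 1 + n] b = x at *
  generalize L.T^[N + 1 + m] b = y at *
  generalize σ n = s at *
  obtain ⟨x, d⟩ := x
  obtain ⟨y, d'⟩ := y
  simp only at hcomp hd hVn hVm hne
  subst hcomp
  have h1 : 0 < s * (y - x) → False := by
    intro h
    refine hm ?_
    convert hVn (s * (y - x)) h ?_ using 2
    · rcases hσn with rfl | rfl <;> ring
    · rw [abs_lt] at hd
      rcases hσn with rfl | rfl <;> linarith
  have h2 : 0 < s * (x - y) → False := by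
    intro h
    refine hn ?_
    convert hVm (s * (x - y)) h ?_ using 2
    · rcases hσn with rfl | rfl <;> ring
    · rw [abs_lt] at hd
      rcases hσn with rfl | rfl <;> linarith
  rcases lt_or_gt_of_ne hne with h | h <;> rcases hσn with rfl | rfl
  · exact h1 (by linarith)
  · exact h2 (by linarith)
  · exact h2 (by linarith)
  · exact h1 (by linarith)

lemma IsOpenInvariant.preimage_s2 {V : Set (ℝ × Bool)} (hV : L.IsOpenInvariant V) :
    L.IsOpenInvariant (s2 ⁻¹' V) where
  subset x hx := L.s2_mem_Ihat.1 (hV.subset hx)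
  isOpen := hV.isOpen.preimage continuous_s2
  invariant x hx := by
    rw [mem_preimage, mem_preimage, ← L.T_s2_T hx]
    exact (hV.invariant _ (L.s2_T_mem_regularSet hx)).symm

lemma iterate_mul_eq {z : ℝ × Bool} {n : ℕ} (h : L.T^[n] z = z) (k : ℕ) : L.T^[n * k] z = z := by
  rw [Function.iterate_mul]
  exact Function.iterate_fixed h k

lemma s2_mem_periodicSet {z : ℝ × Bool} (hz : z ∈ L.periodicSet) : s2 z ∈ L.periodicSet := by
  obtain ⟨hreg, n, hn, hper⟩ := hz
  have hrev : ∀ k, L.T^[k] (s2 z) = s2 (L.T^[n * (k + 1) - k] z) := by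
    intro k
    have h := L.iterate_s2_iterate (z := z) (n := n * (k + 1)) (fun j _ => hreg j) k (by nlinarith)
    rwa [L.iterate_mul_eq hper] at h
  refine ⟨fun k => ?_, n, hn, ?_⟩
  · rw [hrev]
    obtain ⟨j, hj⟩ : ∃ j, n * (k + 1) - k = j + 1 :=
      ⟨n * (k + 1) - k - 1, by
        have : k + 1 ≤ n * (k + 1) := by nlinarith
        omega⟩
    rw [hj, T_iterate_succ]
    exact L.s2_T_mem_regularSet (hreg j)
  · have h := L.iterate_s2_iterate (z := z) (n := n) (fun j _ => hreg j) n le_rfl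
    simpa [hper] using h

lemma isOpenInvariant_periodicSet : L.IsOpenInvariant L.periodicSet where
  subset x hx := (hx.1 0).1
  isOpen := by
    refine isOpen_of_intervals fun x hx => ?_
    obtain ⟨hreg, n, hn, hper⟩ := hx
    obtain ⟨ε, hε, h⟩ := exists_interval_subset (L.isOpen_regular_iterates (n * 2))
      (x := x) fun k _ => hreg k
    obtain ⟨s, hs, hst⟩ := L.iterate_isometry (x := x) hε n fun t ht k hk => h t ht k (by omega)
    refine ⟨ε, hε, fun t ht => ?_⟩
    have hper2 : L.T^[n * 2] (x.1 + t, x.2) = (x.1 + t, x.2) := by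
      have hst' : |s * t| < ε := by
        rcases hs with rfl | rfl <;> simpa using ht
      rw [mul_two, Function.iterate_add_apply, hst t ht, hper, hst _ hst', hper, ← mul_assoc]
      rcases hs with rfl | rfl <;> simp
    refine ⟨fun k => ?_, n * 2, by omega, hper2⟩
    rw [← Nat.mod_add_div k (n * 2), Function.iterate_add_apply, L.iterate_mul_eq hper2]
    exact h t ht _ (Nat.mod_lt _ (by omega))
  invariant x hx := by
    constructor
    · rintro ⟨hreg, n, hn, hper⟩
      have hregx : x ∈ L.forwardRegular := by
        intro k
        cases k with
        | zero => exact hx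
        | succ k => exact hreg k
      refine ⟨hregx, n, hn, L.T_injOn (hregx n) hx ?_⟩
      rw [← T_iterate_succ]
      exact hper
    · rintro ⟨hreg, n, hn, hper⟩
      refine ⟨L.forwardRegular_iterate hreg 1, n, hn, ?_⟩
      rw [← Function.iterate_succ_apply, T_iterate_succ, hper]

/-- Endpoints of invariant open sets are periodic. -/
lemma mem_periodicSet_of_endpoint (hnc : ¬ L.HasConnection) {V : Set (ℝ × Bool)}
    (hV : L.IsOpenInvariant V) {b : ℝ × Bool} (hb : b ∈ L.Ihat) (hbV : b ∉ V)
    {s ε : ℝ} (hs : s = 1 ∨ s = -1) (hε : 0 < ε)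
    (hseg : ∀ t, 0 < t → t < ε → (b.1 + s * t, b.2) ∈ V) : b ∈ L.periodicSet := by
  have hfin := L.finite_Sig hnc
  by_cases hreg : ∀ k, L.T^[k] b ∉ L.Sig
  · have hreg' := L.forwardRegular_of_forall_notMem_Sig hb hreg
    exact ⟨hreg', L.exists_iterate_eq_of_endpoint hfin hV hreg' hbV hs hε hseg⟩
  · push Not at hreg
    obtain ⟨m, hm⟩ := hreg
    have hreg2 : ∀ k, L.T^[k] (s2 b) ∉ L.Sig := by
      by_contra hcon
      push Not at hcon
      classical
      set n := Nat.find hcon with hn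
      have hnS : L.T^[n] (s2 b) ∈ L.Sig := Nat.find_spec hcon
      have hlt : ∀ k < n, L.T^[k] (s2 b) ∈ L.regularSet := by
        intro k
        induction k with
        | zero => exact fun h0 => ⟨L.s2_mem_Ihat.2 hb, Nat.find_min hcon h0⟩
        | succ k ih =>
          intro hk
          refine ⟨?_, Nat.find_min hcon hk⟩
          rw [T_iterate_succ]
          exact L.T_mem_Ihat (ih (by omega))
      refine hnc ⟨_, ⟨_, hnS, rfl⟩, m + n, ?_⟩
      rw [Function.iterate_add_apply, L.iterate_s2_iterate hlt n le_rfl]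
      simpa using hm
    have hreg' := L.forwardRegular_of_forall_notMem_Sig (L.s2_mem_Ihat.2 hb) hreg2
    have h := L.exists_iterate_eq_of_endpoint hfin (hV.preimage_s2) hreg'
      (by simpa using hbV) hs hε (by simpa [s2] using hseg)
    simpa using L.s2_mem_periodicSet ⟨hreg', h⟩

/-- An open set without endpoint in `Î` is a union of components of `Î`. -/
lemma mem_of_no_endpoint {V : Set (ℝ × Bool)} (hV : IsOpen V)
    (hend : ∀ b ∈ L.Ihat, b ∉ V → ∀ s ε : ℝ, (s = 1 ∨ s = -1) → 0 < ε →
      ¬ ∀ t, 0 < t → t < ε → (b.1 + s * t, b.2) ∈ V)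
    {x y : ℝ × Bool} (hx : x ∈ L.Ihat) (hxV : x ∈ V) (hy : y ∈ L.Ihat) (hxy : y.2 = x.2) :
    y ∈ V := by
  by_contra hyV
  have hx' := L.mem_Ihat.1 hx
  have hy' := L.mem_Ihat.1 hy
  have hyV' : (y.1, x.2) ∉ V := by rwa [← hxy]
  have hcl : IsClosed {t : ℝ | (t, x.2) ∉ V} :=
    (hV.isClosed_compl).preimage (by fun_prop : Continuous fun t : ℝ => ((t, x.2) : ℝ × Bool))
  have hne : x.1 ≠ y.1 := fun h => hyV' (by rwa [← h])
  have hcomp : IsCompact (uIcc x.1 y.1 ∩ {t : ℝ | (t, x.2) ∉ V}) := isCompact_uIcc.inter_right hcl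
  have hnonempty : (uIcc x.1 y.1 ∩ {t : ℝ | (t, x.2) ∉ V}).Nonempty :=
    ⟨y.1, right_mem_uIcc, hyV'⟩
  rcases lt_or_gt_of_ne hne with hlt | hlt
  · obtain ⟨b, ⟨hb, hbV⟩, hleast⟩ := hcomp.exists_isLeast hnonempty
    rw [uIcc_of_le hlt.le] at hb
    have hbx : x.1 < b := lt_of_le_of_ne hb.1 fun h => hbV (by rwa [← h])
    refine hend (b, x.2) (L.mem_Ihat.2 ⟨hx'.1.trans hbx, hb.2.trans_lt hy'.2⟩) hbV (-1) (b - x.1)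
      (Or.inr rfl) (by linarith) fun t ht htb => ?_
    by_contra hcon
    have := hleast ⟨by
      rw [uIcc_of_le hlt.le]
      constructor <;> simp only <;> linarith [hb.2], hcon⟩
    simp only at this
    linarith
  · obtain ⟨b, ⟨hb, hbV⟩, hgreatest⟩ := hcomp.exists_isGreatest hnonempty
    rw [uIcc_of_ge hlt.le] at hb
    have hbx : b < x.1 := lt_of_le_of_ne hb.2 fun h => hbV (by rwa [h])
    refine hend (b, x.2) (L.mem_Ihat.2 ⟨hy'.1.trans_le hb.1, hbx.trans hx'.2⟩) hbV 1 (x.1 - b)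
      (Or.inl rfl) (by linarith) fun t ht htb => ?_
    by_contra hcon
    have := hgreatest ⟨by
      rw [uIcc_of_ge hlt.le]
      constructor <;> simp only <;> linarith [hb.1], hcon⟩
    simp only at this
    linarith

/-- Without connection but with singularities, there is no regular periodic orbit. -/
lemma periodicSet_eq_empty (hnc : ¬ L.HasConnection) (hS : L.Sig.Nonempty) :
    L.periodicSet = ∅ := by
  by_contra hne
  obtain ⟨x, hx⟩ := nonempty_iff_ne_empty.2 hne
  obtain ⟨σ, hσ⟩ := hS
  have hP := L.isOpenInvariant_periodicSet
  have hσ' : σ ∈ L.Ihat := L.Sig_sub hσ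
  have hend : ∀ b ∈ L.Ihat, b ∉ L.periodicSet → ∀ s ε : ℝ, (s = 1 ∨ s = -1) → 0 < ε →
      ¬ ∀ t, 0 < t → t < ε → (b.1 + s * t, b.2) ∈ L.periodicSet :=
    fun b hb hbP s ε hs hε h => hbP (L.mem_periodicSet_of_endpoint hnc hP hb hbP hs hε h)
  have hσP : σ ∈ L.periodicSet := by
    by_cases hcomp : σ.2 = x.2
    · exact L.mem_of_no_endpoint hP.isOpen hend (hP.subset hx) hx hσ' hcomp
    · have hx2 := L.s2_mem_periodicSet hx
      refine L.mem_of_no_endpoint hP.isOpen hend (hP.subset hx2) hx2 hσ' ?_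
      simp only [s2]
      revert hcomp
      cases σ.2 <;> cases x.2 <;> simp
  exact (hσP.1 0).2 hσ

/-- Without connection but with singularities, every invariant open set is a union of components
of `Î`. -/
lemma IsOpenInvariant.mem_of_mem (hnc : ¬ L.HasConnection) (hS : L.Sig.Nonempty)
    {V : Set (ℝ × Bool)} (hV : L.IsOpenInvariant V) {x y : ℝ × Bool} (hx : x ∈ V)
    (hy : y ∈ L.Ihat) (hxy : y.2 = x.2) : y ∈ V := by
  refine L.mem_of_no_endpoint hV.isOpen (fun b hb hbV s ε hs hε h => ?_) (hV.subset hx) hx hy hxy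
  have := L.mem_periodicSet_of_endpoint hnc hV hb hbV hs hε h
  rw [L.periodicSet_eq_empty hnc hS] at this
  exact this

/-- Near the ends of `I`, the map `T` preserves the distance to the ends of `I`. -/
lemma exists_margin : ∃ η > 0, ∀ z ∈ L.regularSet, min (z.1 - L.lo) (L.hi - z.1) < η →
    min ((L.T z).1 - L.lo) (L.hi - (L.T z).1) < η →
    min ((L.T z).1 - L.lo) (L.hi - (L.T z).1) = min (z.1 - L.lo) (L.hi - z.1) := by
  have hlohi := L.lo_lt_hi
  set E : Set ℝ := (range L.endLo ∪ range L.endHi) \ {L.lo, L.hi} with hE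
  have hEfin : E.Finite := ((finite_range _).union (finite_range _)).sdiff
  have hopen : IsOpen Eᶜ := hEfin.isClosed.isOpen_compl
  obtain ⟨ε₁, hε₁, h₁⟩ := Metric.isOpen_iff.1 hopen L.lo (by simp [hE])
  obtain ⟨ε₂, hε₂, h₂⟩ := Metric.isOpen_iff.1 hopen L.hi (by simp [hE])
  set η := min (min ε₁ ε₂) (L.hi - L.lo) / 2 with hη
  have hη₁ : 2 * η ≤ ε₁ := by
    have := (min_le_left _ _).trans (min_le_left _ _) (a := min (min ε₁ ε₂) (L.hi - L.lo))
    linarith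
  have hη₂ : 2 * η ≤ ε₂ := by
    have := (min_le_left _ _).trans (min_le_right _ _) (a := min (min ε₁ ε₂) (L.hi - L.lo))
    linarith
  have hη₃ : 2 * η ≤ L.hi - L.lo := by
    have := min_le_right (min ε₁ ε₂) (L.hi - L.lo)
    linarith
  have hηpos : 0 < η := by
    have : 0 < min (min ε₁ ε₂) (L.hi - L.lo) := lt_min (lt_min hε₁ hε₂) (by linarith)
    linarith
  have hgap : ∀ e ∈ range L.endLo ∪ range L.endHi, L.lo ≤ e → e ≤ L.hi →
      (e = L.lo ∨ L.lo + 2 * η ≤ e) ∧ (e = L.hi ∨ e ≤ L.hi - 2 * η) := by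
    intro e he hlo hhi
    by_cases heE : e ∈ E
    · refine ⟨Or.inr ?_, Or.inr ?_⟩
      · by_contra hcon
        refine h₁ ?_ heE
        rw [Metric.mem_ball, Real.dist_eq, abs_lt]
        constructor <;> linarith
      · by_contra hcon
        refine h₂ ?_ heE
        rw [Metric.mem_ball, Real.dist_eq, abs_lt]
        constructor <;> linarith
    · have : e = L.lo ∨ e = L.hi := by
        by_contra hcon
        exact heE ⟨he, by simpa using hcon⟩
      rcases this with rfl | rfl
      · exact ⟨Or.inl rfl, Or.inr (by linarith)⟩
      · exact ⟨Or.inr (by linarith), Or.inl rfl⟩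
  refine ⟨η, hηpos, fun z hz hdz hdT => ?_⟩
  obtain ⟨c, hc⟩ := L.mem_regularSet.1 hz
  obtain ⟨⟨hc1, hc2⟩, -⟩ := L.mem_Ia.1 hc
  have hlen := L.len_inv c
  have hlt := L.end_lt c
  have b1 := L.sub_lo c
  have b2 := L.sub_hi c
  have b3 := L.sub_lo (Letter.inv c)
  have b4 := L.sub_hi (Letter.inv c)
  obtain ⟨g1, g2⟩ := hgap (L.endLo c) (Or.inl ⟨c, rfl⟩) b1 (by linarith)
  obtain ⟨g3, g4⟩ := hgap (L.endHi c) (Or.inr ⟨c, rfl⟩) (by linarith) b2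
  obtain ⟨g5, g6⟩ := hgap (L.endLo (Letter.inv c)) (Or.inl ⟨_, rfl⟩) b3 (by linarith)
  obtain ⟨g7, g8⟩ := hgap (L.endHi (Letter.inv c)) (Or.inr ⟨_, rfl⟩) (by linarith) b4
  rcases L.T_formula c with h | h <;> rw [h z hc] at hdT ⊢ <;> simp only at hdT ⊢ <;>
    generalize z.1 = x at * <;> generalize L.endLo c = p at * <;> generalize L.endHi c = q at * <;>
    generalize L.endLo (Letter.inv c) = p' at * <;>
    generalize L.endHi (Letter.inv c) = q' at * <;> clear h₁ h₂ hgap h hη hE <;>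
    rcases min_lt_iff.1 hdz with hdz | hdz <;> rcases min_lt_iff.1 hdT with hdT | hdT
  · have e1 : p = L.lo := g1.resolve_right (by linarith)
    have e2 : p' = L.lo := g5.resolve_right (by linarith)
    rw [e1, e2]; congr 1 <;> ring
  · exfalso; rcases g6 with e | e <;> linarith
  · exfalso; rcases g3 with e | e <;> rcases g7 with e' | e' <;> linarith
  · have e1 : q = L.hi := g4.resolve_right (by linarith)
    have e2 : q' = L.hi := g8.resolve_right (by linarith)
    congr 1 <;> linarith
  · exfalso; rcases g7 with e' | e' <;> linarith
  · have e1 : p = L.lo := g1.resolve_right (by linarith)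
    have e2 : q' = L.hi := g8.resolve_right (by linarith)
    rw [e1, e2, min_comm]; congr 1 <;> ring
  · have e1 : q = L.hi := g4.resolve_right (by linarith)
    have e2 : p' = L.lo := g5.resolve_right (by linarith)
    rw [min_comm]; congr 1 <;> linarith
  · exfalso; rcases g6 with e | e <;> linarith

/-- An open set meeting the orbits of both components of `Î` is reached in bounded time by every
regular point. -/
lemma exists_bounded_hitting (hnc : ¬ L.HasConnection) (hS : L.Sig.Nonempty)
    {W : Set (ℝ × Bool)} (hW : IsOpen W) (hWsub : W ⊆ L.Ihat)
    (hWcomp : ∀ V, L.IsOpenInvariant V → W ⊆ V → ∀ δ : Bool, ∃ y ∈ V, y.2 = δ) :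
    ∃ N, ∀ z ∈ L.forwardRegular, ∃ i ≤ N, L.T^[i] z ∈ W := by
  by_contra hcon
  push Not at hcon
  choose z hz hzW using hcon
  set V : Set (ℝ × Bool) := {y | y ∈ L.Ihat ∧ ∃ N, IsOpen N ∧ y ∈ N ∧
    ∃ M, ∀ n i, M ≤ i → i + M ≤ n → L.T^[i] (z n) ∉ N} with hVdef
  have hV : L.IsOpenInvariant V := by
    refine ⟨fun x hx => hx.1, ?_, fun x hx => ⟨?_, ?_⟩⟩
    · rw [isOpen_iff_forall_mem_open]
      rintro x ⟨hxI, N, hN, hxN, hM⟩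
      exact ⟨L.Ihat ∩ N, fun y hy => ⟨hy.1, N, hN, hy.2, hM⟩, L.isOpen_Ihat.inter hN, hxI, hxN⟩
    · rintro ⟨-, N, hN, hxN, M, hM⟩
      refine ⟨hx.1, _, L.isOpen_preimage_T hN, ⟨hx, hxN⟩, M + 1, fun n i h1 h2 h3 => ?_⟩
      refine hM n (i + 1) (by omega) (by omega) ?_
      rw [T_iterate_succ]
      exact h3.2
    · rintro ⟨-, N, hN, hxN, M, hM⟩
      refine ⟨L.T_mem_Ihat hx, s2 ⁻¹' (L.regularSet ∩ L.T ⁻¹' (s2 ⁻¹' N)),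
        (L.isOpen_preimage_T (hN.preimage continuous_s2)).preimage continuous_s2,
        ⟨L.s2_T_mem_regularSet hx, ?_⟩, M + 1, fun n i h1 h2 h3 => ?_⟩
      · rw [mem_preimage, mem_preimage, L.T_s2_T hx, s2_s2]
        exact hxN
      · obtain ⟨j, rfl⟩ : ∃ j, i = j + 1 := ⟨i - 1, by omega⟩
        have h4 := h3.2
        rw [T_iterate_succ, mem_preimage, mem_preimage, L.T_s2_T (hz n j), s2_s2] at h4
        exact hM n j (by omega) (by omega) h4
  have hWV : W ⊆ V := fun y hy =>
    ⟨hWsub hy, W, hW, hy, 0, fun n i _ h => hzW n i (by omega)⟩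
  have hVall : L.Ihat ⊆ V := by
    intro y hy
    obtain ⟨x, hx, hxy⟩ := hWcomp V hV hWV y.2
    exact hV.mem_of_mem L hnc hS hx hy hxy.symm
  obtain ⟨η, hη, hmargin⟩ := L.exists_margin
  have hK : IsCompact (Icc (L.lo + η) (L.hi - η) ×ˢ (univ : Set Bool)) :=
    isCompact_Icc.prod isCompact_univ
  obtain ⟨M, hM⟩ := hK.induction_on
    (p := fun S => ∃ M, ∀ n i, M ≤ i → i + M ≤ n → L.T^[i] (z n) ∉ S)
    ⟨0, by simp⟩
    (fun S S' hSS' ⟨M, hM⟩ => ⟨M, fun n i h1 h2 h3 => hM n i h1 h2 (hSS' h3)⟩)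
    (fun S S' ⟨M, hM⟩ ⟨M', hM'⟩ => ⟨M + M', fun n i h1 h2 h3 => h3.elim
      (hM n i (by omega) (by omega)) (hM' n i (by omega) (by omega))⟩)
    (fun x hx => by
      have hxI : x ∈ L.Ihat := L.mem_Ihat.2 ⟨by linarith [hx.1.1], by linarith [hx.1.2]⟩
      obtain ⟨-, N, hN, hxN, hM⟩ := hVall hxI
      exact ⟨N, mem_nhdsWithin_of_mem_nhds (hN.mem_nhds hxN), hM⟩)
  set q : ℕ → ℝ × Bool := fun j => L.T^[M + j] (z (2 * M + 4)) with hq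
  have hqreg : ∀ j, q j ∈ L.forwardRegular := fun j => L.forwardRegular_iterate (hz _) _
  have hqd : ∀ j ≤ 4, min ((q j).1 - L.lo) (L.hi - (q j).1) < η := by
    intro j hj
    by_contra hcon
    rw [not_lt, le_min_iff] at hcon
    exact hM (2 * M + 4) (M + j) (by omega) (by omega)
      ⟨⟨by linarith [hcon.1], by linarith [hcon.2]⟩, mem_univ _⟩
  have hqconst : ∀ j ≤ 4, min ((q j).1 - L.lo) (L.hi - (q j).1) =
      min ((q 0).1 - L.lo) (L.hi - (q 0).1) := by
    intro j
    induction j with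
    | zero => simp
    | succ j ih =>
      intro hj
      rw [← ih (by omega)]
      have hstep : q (j + 1) = L.T (q j) := by rw [hq]; simp only; rw [← add_assoc, T_iterate_succ]
      have := hqd (j + 1) hj
      rw [hstep] at this ⊢
      exact hmargin _ (hqreg j 0) (hqd j (by omega)) this
  obtain ⟨i, j, hij, heq⟩ := Fintype.exists_ne_map_eq_of_card_lt
    (fun j : Fin 5 => ((q j).2, decide ((q j).1 - L.lo ≤ L.hi - (q j).1))) (by simp)
  simp only [Prod.mk.injEq, decide_eq_decide] at heq
  have hqeq : q i = q j := by
    refine Prod.ext ?_ heq.1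
    have h := (hqconst i (by omega)).trans (hqconst j (by omega)).symm
    by_cases hle : (q i).1 - L.lo ≤ L.hi - (q i).1
    · rw [min_eq_left hle, min_eq_left (heq.2.1 hle)] at h
      linarith
    · rw [min_eq_right (not_le.1 hle).le, min_eq_right (not_le.1 (mt heq.2.2 hle)).le] at h
      linarith
  have key : ∀ i j : ℕ, i < j → q i = q j → False := by
    intro i j hij h
    have : q i ∈ L.periodicSet := by
      refine ⟨hqreg i, j - i, by omega, ?_⟩
      simp only [hq] at h ⊢
      rw [← Function.iterate_add_apply, h, show j - i + (M + i) = M + j by omega]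
    rw [L.periodicSet_eq_empty hnc hS] at this
    exact this
  rcases lt_or_gt_of_ne hij with h | h
  · exact key i j h hqeq
  · exact key j i h hqeq.symm

lemma Iw_subset (u : List (Letter A)) : L.Iw u ⊆ L.Ihat := inter_subset_left

lemma mem_Iw {u : List (Letter A)} {z : ℝ × Bool} :
    z ∈ L.Iw u ↔ z ∈ L.Ihat ∧ ∀ (i : ℕ) (hi : i < u.length), L.T^[i] z ∈ L.Ia u[i] := by
  simp only [Iw, mem_inter_iff, mem_iInter, mem_preimage, List.get_eq_getElem]
  exact and_congr_right fun _ => ⟨fun h i hi => h ⟨i, hi⟩, fun h i => h i i.2⟩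

lemma Iw_cons (c : Letter A) (u : List (Letter A)) :
    L.Iw (c :: u) = L.Ia c ∩ (L.regularSet ∩ L.T ⁻¹' L.Iw u) := by
  ext z
  simp only [mem_inter_iff, mem_preimage, mem_Iw]
  constructor
  · rintro ⟨h1, h2⟩
    have h3 : z ∈ L.Ia c := h2 0 (by simp)
    have h4 := L.mem_regularSet.2 ⟨c, h3⟩
    exact ⟨h3, h4, L.T_mem_Ihat h4, fun i hi => h2 (i + 1) (by simpa using hi)⟩
  · rintro ⟨h1, h2, -, h3⟩
    refine ⟨h2.1, fun i hi => ?_⟩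
    cases i with
    | zero => exact h1
    | succ i => exact h3 i (by simpa using hi)

lemma isOpen_Iw (u : List (Letter A)) : IsOpen (L.Iw u) := by
  induction u with
  | nil => simpa [Iw] using L.isOpen_Ihat
  | cons c u ih =>
    rw [Iw_cons]
    exact (L.isOpen_Ia c).inter (L.isOpen_preimage_T ih)

/-- The words of the natural coding are the codings of the forward regular points. -/
lemma exists_of_mem_lang {u : List (Letter A)} (hu : u ∈ L.lang) :
    ∃ z ∈ L.forwardRegular, z ∈ L.Iw u := by
  obtain ⟨z, ⟨hz, hzO⟩, m, h⟩ := hu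
  have hreg : z ∈ L.forwardRegular := L.forwardRegular_of_forall_notMem_Sig hz fun k hk =>
    hzO (Or.inl (mem_iUnion.2 ⟨k, hk⟩))
  refine ⟨_, L.forwardRegular_iterate hreg m, L.mem_Iw.2 ⟨(hreg m).1, fun i hi => ?_⟩⟩
  rw [← Function.iterate_add_apply, add_comm]
  exact h ⟨i, hi⟩

lemma exists_append_mem_lang {u : List (Letter A)} (hu : u ∈ L.lang) :
    ∃ c, u ++ [c] ∈ L.lang := by
  obtain ⟨z, ⟨hz, hzO⟩, m, h⟩ := hu
  have hreg : z ∈ L.forwardRegular := L.forwardRegular_of_forall_notMem_Sig hz fun k hk =>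
    hzO (Or.inl (mem_iUnion.2 ⟨k, hk⟩))
  obtain ⟨c, hc⟩ := L.mem_regularSet.1 (hreg (m + u.length))
  refine ⟨c, z, ⟨hz, hzO⟩, m, ?_⟩
  rintro ⟨i, hi⟩
  simp only [List.get_eq_getElem, List.getElem_append]
  split_ifs with h'
  · exact h ⟨i, h'⟩
  · obtain rfl : i = u.length := by simp at hi; omega
    simpa using hc

/-- If the coding of a point is `w` and one of its iterates lies in `I_u`, then `u` occurs
in `w`. -/
lemma isInfix_of_iterate_mem {u w : List (Letter A)} {z : ℝ × Bool} (hw : z ∈ L.Iw w) {i : ℕ}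
    (hi : i + u.length ≤ w.length) (hu : L.T^[i] z ∈ L.Iw u) : u <:+: w := by
  have : u = (w.drop i).take u.length := by
    refine List.ext_getElem (by simp; omega) fun j h1 h2 => ?_
    have h3 := (L.mem_Iw.1 hu).2 j h1
    have h4 := (L.mem_Iw.1 hw).2 (i + j) (by omega)
    rw [← Function.iterate_add_apply, add_comm] at h3
    rw [L.letter_unique h3 h4]
    simp
  refine ⟨w.take i, (w.drop i).drop u.length, ?_⟩
  nth_rewrite 1 [this]
  rw [List.append_assoc, List.take_append_drop, List.take_append_drop]

/-- The inverse word codes the reversed orbit. -/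
lemma s2_iterate_mem_Iw {u : List (Letter A)} {z : ℝ × Bool} (hz : z ∈ L.Iw u) :
    s2 (L.T^[u.length] z) ∈ L.Iw (wordInv u) := by
  have hz' := L.mem_Iw.1 hz
  have hreg : ∀ k < u.length, L.T^[k] z ∈ L.regularSet := fun k hk =>
    L.mem_regularSet.2 ⟨_, hz'.2 k hk⟩
  refine L.mem_Iw.2 ⟨?_, fun i hi => ?_⟩
  · rw [s2_mem_Ihat]
    rcases Nat.eq_zero_or_pos u.length with h | h
    · rw [h]
      exact hz'.1
    · obtain ⟨k, hk⟩ : ∃ k, u.length = k + 1 := ⟨u.length - 1, by omega⟩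
      rw [hk, T_iterate_succ]
      exact L.T_mem_Ihat (hreg k (by omega))
  · have hi' : i < u.length := by simpa [wordInv] using hi
    rw [L.iterate_s2_iterate hreg i (by omega),
      show u.length - i = (u.length - 1 - i) + 1 by omega, T_iterate_succ, s2_T]
    simpa [wordInv] using L.s1_mem_Ia (hz'.2 (u.length - 1 - i) (by omega))

/-- An orientable linear involution preserves the components of `Î`. -/
lemma T_snd_of_orientable (ho : L.Orientable) {z : ℝ × Bool} (hz : z ∈ L.regularSet) :
    (L.T z).2 = z.2 := by
  obtain ⟨c, hc⟩ := L.mem_regularSet.1 hz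
  have h1 := (L.mem_Ia.1 hc).2
  have h2 := (L.mem_Ia.1 (L.s1_mem_Ia hc)).2
  have h3 : L.comp c ≠ L.comp (Letter.inv c) := fun h => ho ⟨c, h⟩
  rw [T, s2, h2, h1]
  simp only
  revert h3
  cases L.comp c <;> cases L.comp (Letter.inv c) <;> simp

lemma iterate_snd_of_orientable (ho : L.Orientable) {z : ℝ × Bool} {n : ℕ}
    (hz : ∀ k < n, L.T^[k] z ∈ L.regularSet) : (L.T^[n] z).2 = z.2 := by
  induction n with
  | zero => rfl
  | succ n ih =>
    rw [T_iterate_succ, L.T_snd_of_orientable ho (hz n (by omega)), ih fun k hk => hz k (by omega)]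

lemma Ia_nonempty (c : Letter A) : (L.Ia c).Nonempty := by
  obtain ⟨x, hx⟩ := exists_between (L.end_lt c)
  exact ⟨(x, L.comp c), L.mem_Ia.2 ⟨hx, rfl⟩⟩

/-- Without singularities, each component of `Î` is a single interval `I_c`. -/
lemma mem_Ia_of_Sig_eq_empty (hS : L.Sig = ∅) {c : Letter A} {x y : ℝ × Bool} (hx : x ∈ L.Ia c)
    (hy : y ∈ L.Ihat) (hxy : y.2 = x.2) : y ∈ L.Ia c := by
  refine L.mem_Ia_of_segment hx hxy fun r hr => ⟨?_, by simp [hS]⟩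
  have hx' := L.mem_Ihat.1 (L.mem_regularSet.2 ⟨c, hx⟩).1
  have hy' := L.mem_Ihat.1 hy
  rw [mem_uIcc] at hr
  refine L.mem_Ihat.2 ?_
  rcases hr with hr | hr <;> constructor <;> simp only <;> linarith

lemma orientable_of_Sig_eq_empty (hS : L.Sig = ∅) : L.Orientable := by
  rintro ⟨c, hc⟩
  obtain ⟨x, hx⟩ := L.Ia_nonempty c
  obtain ⟨y, hy⟩ := L.Ia_nonempty (Letter.inv c)
  refine Letter.inv_ne c (L.letter_unique hy (L.mem_Ia_of_Sig_eq_empty hS hx ?_ ?_))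
  · exact (L.mem_regularSet.2 ⟨_, hy⟩).1
  · rw [(L.mem_Ia.1 hx).2, (L.mem_Ia.1 hy).2, hc]

lemma mem_Iw_of_Sig_eq_empty (hS : L.Sig = ∅) {u : List (Letter A)} {x y : ℝ × Bool}
    (hx : x ∈ L.Iw u) (hy : y ∈ L.forwardRegular) (hxy : y.2 = x.2) : y ∈ L.Iw u := by
  have ho := L.orientable_of_Sig_eq_empty hS
  have hx' := L.mem_Iw.1 hx
  refine L.mem_Iw.2 ⟨(hy 0).1, fun i hi => ?_⟩
  refine L.mem_Ia_of_Sig_eq_empty hS (hx'.2 i hi) (hy i).1 ?_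
  rw [L.iterate_snd_of_orientable ho fun k _ => hy k, hxy, L.iterate_snd_of_orientable ho]
  exact fun k hk => L.mem_regularSet.2 ⟨_, hx'.2 k (by omega)⟩

/-- For an orientable linear involution, every component of `Î` contains a point coded by `u`
or by its inverse. -/
lemma exists_mem_Iw_union (ho : L.Orientable) {u : List (Letter A)} (hu : (L.Iw u).Nonempty)
    (δ : Bool) : ∃ y ∈ L.Iw u ∪ L.Iw (wordInv u), y.2 = δ := by
  obtain ⟨y, hy⟩ := hu
  by_cases hδ : y.2 = δ
  · exact ⟨y, Or.inl hy, hδ⟩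
  · refine ⟨_, Or.inr (L.s2_iterate_mem_Iw hy), ?_⟩
    have := L.iterate_snd_of_orientable ho (z := y) (n := u.length)
      fun k hk => L.mem_regularSet.2 ⟨_, (L.mem_Iw.1 hy).2 k hk⟩
    simp only [s2, this]
    revert hδ
    cases y.2 <;> cases δ <;> simp

/-- For a nonorientable linear involution, nonempty invariant open sets meet both components
of `Î`. -/
lemma IsOpenInvariant.exists_snd_eq (hnc : ¬ L.HasConnection) (hS : L.Sig.Nonempty)
    (hno : L.Nonorientable) {V : Set (ℝ × Bool)} (hV : L.IsOpenInvariant V) (hne : V.Nonempty)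
    (δ : Bool) : ∃ y ∈ V, y.2 = δ := by
  obtain ⟨c, hc⟩ := hno
  obtain ⟨x, hx⟩ := L.Ia_nonempty c
  obtain ⟨y, hy⟩ := hne
  have hxr := L.mem_regularSet.2 ⟨c, hx⟩
  have hx2 := (L.mem_Ia.1 hx).2
  have hT : (L.T x).2 = !x.2 := by
    rw [T, s2, (L.mem_Ia.1 (L.s1_mem_Ia hx)).2, hx2, hc]
  have hxV : x ∈ V := by
    by_cases h : x.2 = y.2
    · exact hV.mem_of_mem L hnc hS hy hxr.1 h
    · refine (hV.invariant x hxr).1 (hV.mem_of_mem L hnc hS hy (L.T_mem_Ihat hxr) ?_)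
      rw [hT]
      revert h
      cases x.2 <;> cases y.2 <;> simp
  by_cases h : x.2 = δ
  · exact ⟨x, hxV, h⟩
  · refine ⟨_, (hV.invariant x hxr).2 hxV, ?_⟩
    rw [hT]
    revert h
    cases x.2 <;> cases δ <;> simp

end LinearInvolution

/-- For a linear involution without connection, `L(T)` is
uniformly recurrent if `T` is nonorientable, and uniformly semi-recurrent if
`T` is orientable. -/
theorem stmt_7 {A : Type*} [Fintype A] (L : LinearInvolution A)
    (hnc : ¬ L.HasConnection) :
    (L.Nonorientable → UniformlyRecurrent L.lang) ∧
    (L.Orientable → UniformlySemiRecurrent L.lang) := by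
  refine ⟨fun hno => ⟨fun u hu => L.exists_append_mem_lang hu, fun u hu => ?_⟩,
    fun ho => ⟨fun u hu => L.exists_append_mem_lang hu, fun u hu => ?_⟩⟩
  · obtain ⟨x, -, hx⟩ := L.exists_of_mem_lang hu
    have hS : L.Sig.Nonempty := nonempty_iff_ne_empty.2 fun h =>
      L.orientable_of_Sig_eq_empty h hno
    obtain ⟨N, hN⟩ := L.exists_bounded_hitting hnc hS (L.isOpen_Iw u) (L.Iw_subset u)
      fun V hV hWV δ => hV.exists_snd_eq L hnc hS hno ⟨x, hWV hx⟩ δ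
    refine ⟨N + u.length + 1, by omega, fun w hw hlen => ?_⟩
    obtain ⟨z, hz, hzw⟩ := L.exists_of_mem_lang hw
    obtain ⟨i, hi, hiu⟩ := hN z hz
    exact L.isInfix_of_iterate_mem hzw (by omega) hiu
  · obtain ⟨x, -, hx⟩ := L.exists_of_mem_lang hu
    have hlen_inv : (wordInv u).length = u.length := by simp [wordInv]
    obtain ⟨N, hN⟩ : ∃ N, ∀ z ∈ L.forwardRegular, ∃ i ≤ N,
        L.T^[i] z ∈ L.Iw u ∪ L.Iw (wordInv u) := by
      rcases L.Sig.eq_empty_or_nonempty with hS | hS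
      · refine ⟨0, fun z hz => ⟨0, le_rfl, ?_⟩⟩
        obtain ⟨y, hy, hyz⟩ := L.exists_mem_Iw_union ho ⟨x, hx⟩ z.2
        exact hy.imp (fun h => L.mem_Iw_of_Sig_eq_empty hS h hz hyz.symm)
          (fun h => L.mem_Iw_of_Sig_eq_empty hS h hz hyz.symm)
      · refine L.exists_bounded_hitting hnc hS ((L.isOpen_Iw u).union (L.isOpen_Iw _))
          (union_subset (L.Iw_subset u) (L.Iw_subset _)) fun V _ hWV δ => ?_
        obtain ⟨y, hy, hyδ⟩ := L.exists_mem_Iw_union ho ⟨x, hx⟩ δ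
        exact ⟨y, hWV hy, hyδ⟩
    refine ⟨N + u.length + 1, by omega, fun w hw hlen => ?_⟩
    obtain ⟨z, hz, hzw⟩ := L.exists_of_mem_lang hw
    obtain ⟨i, hi, hiu⟩ := hN z hz
    exact hiu.imp (L.isInfix_of_iterate_mem hzw (by omega))
      (L.isInfix_of_iterate_mem hzw (by omega))

end LinInv
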